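/- Let N be a weight sequence in the class 𝓛𝓒 which is nonquasianalytic, and let s ∈ ℕ_{>0}, C ≥ 1. If the equivalence S^N ≈ L^{s,C} fails, then N does not satisfy (γ₁) and the equivalence N ≈ L^{s,C} fails as well. -/

import Mathlib

open Filter

noncomputable def nuq (N : ℕ → ℝ) (p : ℕ) : ℝ := N p / N (p - 1)

def IsLC (N : ℕ → ℝ) : Prop :=
  (∀ p, 0 < N p) ∧ N 0 = 1 ∧ N 0 ≤ N 1 ∧
    (∀ p, 1 ≤ p → (N p) ^ 2 ≤ N (p - 1) * N (p + 1)) ∧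
    Tendsto (fun p : ℕ => (N p) ^ ((1 : ℝ) / p)) atTop atTop

def NQA (N : ℕ → ℝ) : Prop := Summable (fun p : ℕ => 1 / nuq N (p + 1))

noncomputable def tailSum (N : ℕ → ℝ) (p : ℕ) : ℝ := ∑' k : ℕ, 1 / nuq N (p + k)

noncomputable def lamSV (M N : ℕ → ℝ) (s p : ℕ) : ℝ :=
  ⨆ j : Fin p, (M p / ((s : ℝ) ^ p * N j)) ^ ((1 : ℝ) / ((p : ℝ) - (j : ℕ)))

def SVcond (M N : ℕ → ℝ) : Prop :=
  ∃ s : ℕ, 1 ≤ s ∧ ∃ B : ℝ, ∀ p : ℕ, 1 ≤ p → lamSV M N s p / p * tailSum N p ≤ B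

noncomputable def Lseq (N : ℕ → ℝ) (s p : ℕ) : ℝ :=
  if p = 0 then 1
  else (s : ℝ) ^ p * ⨅ j : Fin p, ((p : ℝ) / tailSum N p) ^ (p - (j : ℕ)) * N j

noncomputable def LseqC (N : ℕ → ℝ) (s : ℕ) (C : ℝ) (p : ℕ) : ℝ :=
  if p = 0 then 1
  else (s : ℝ) ^ p * ⨅ j : Fin p, (C * p / tailSum N p) ^ (p - (j : ℕ)) * N j

def Preceq (M N : ℕ → ℝ) : Prop :=
  ∃ B : ℝ, ∀ p : ℕ, 1 ≤ p → (M p / N p) ^ ((1 : ℝ) / p) ≤ B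

def SeqEquiv (M N : ℕ → ℝ) : Prop := Preceq M N ∧ Preceq N M

def Gamma1 (N : ℕ → ℝ) : Prop :=
  ∃ B : ℝ, ∀ p : ℕ, 1 ≤ p → nuq N p / p * tailSum N p ≤ B

def MG (N : ℕ → ℝ) : Prop :=
  ∃ C : ℝ, 1 ≤ C ∧ ∀ j k : ℕ, N (j + k) ≤ C ^ (j + k) * N j * N k

noncomputable def tauD (N : ℕ → ℝ) (p : ℕ) : ℝ := p / nuq N p + tailSum N p

noncomputable def sigmaD (N : ℕ → ℝ) (p : ℕ) : ℝ :=
  if p = 0 then 1 else tauD N 1 * p / tauD N p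

noncomputable def Sdesc (N : ℕ → ℝ) (p : ℕ) : ℝ :=
  ∏ i ∈ Finset.range (p + 1), sigmaD N i

def AlmostIncreasing (a : ℕ → ℝ) : Prop :=
  ∃ C : ℝ, 1 ≤ C ∧ ∀ p q : ℕ, 1 ≤ p → p ≤ q → a p ≤ C * a q

noncomputable def BorelMap (f : ℝ → ℂ) : ℕ → ℂ := fun p => iteratedDeriv p f 0

def DRoumieu (N : ℕ → ℝ) : Set (ℝ → ℂ) :=
  {f | ContDiff ℝ (⊤ : ℕ∞) f ∧ Function.support f ⊆ Set.Icc (-1 : ℝ) 1 ∧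
    ∃ C h : ℝ, 0 < C ∧ 0 < h ∧ ∀ p x, ‖iteratedDeriv p f x‖ ≤ C * h ^ p * N p}

def LambdaRoumieu (M : ℕ → ℝ) : Set (ℕ → ℂ) :=
  {a | ∃ C h : ℝ, 0 < C ∧ 0 < h ∧ ∀ p, ‖a p‖ ≤ C * h ^ p * M p}

def DBeurling (N : ℕ → ℝ) : Set (ℝ → ℂ) :=
  {f | ContDiff ℝ (⊤ : ℕ∞) f ∧ Function.support f ⊆ Set.Icc (-1 : ℝ) 1 ∧
    ∀ h : ℝ, 0 < h → ∃ C : ℝ, 0 < C ∧ ∀ p x, ‖iteratedDeriv p f x‖ ≤ C * h ^ p * N p}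

def LambdaBeurling (M : ℕ → ℝ) : Set (ℕ → ℂ) :=
  {a | ∀ h : ℝ, 0 < h → ∃ C : ℝ, 0 < C ∧ ∀ p, ‖a p‖ ≤ C * h ^ p * M p}

section WeightSequences

variable {N : ℕ → ℝ}

lemma preceq_of_le_pow_mul {M N : ℕ → ℝ} (hM : ∀ p, 0 < M p) (hN : ∀ p, 0 < N p) {D : ℝ}
    (hD : 0 ≤ D) (h : ∀ p, 1 ≤ p → M p ≤ D ^ p * N p) : Preceq M N := by
  refine ⟨D, fun p hp => ?_⟩
  have hp0 : p ≠ 0 := by omega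
  calc (M p / N p) ^ ((1 : ℝ) / p) ≤ (D ^ p) ^ ((1 : ℝ) / p) := by
        refine Real.rpow_le_rpow (div_pos (hM p) (hN p)).le ?_ (by positivity)
        rw [div_le_iff₀ (hN p)]
        exact h p hp
    _ = D := by rw [one_div, Real.pow_rpow_inv_natCast hD hp0]

lemma Preceq.exists_le_pow_mul {M N : ℕ → ℝ} (hM : ∀ p, 0 < M p) (hN : ∀ p, 0 < N p)
    (h : Preceq M N) : ∃ D : ℝ, 0 < D ∧ ∀ p, 1 ≤ p → M p ≤ D ^ p * N p := by
  obtain ⟨B, hB⟩ := h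
  have hpos : ∀ p, 0 < M p / N p := fun p => div_pos (hM p) (hN p)
  refine ⟨B, (Real.rpow_pos_of_pos (hpos 1) _).trans_le (hB 1 le_rfl), fun p hp => ?_⟩
  have hp0 : p ≠ 0 := by omega
  rw [← div_le_iff₀ (hN p)]
  calc M p / N p = ((M p / N p) ^ ((1 : ℝ) / p)) ^ p := by
        rw [one_div, Real.rpow_inv_natCast_pow (hpos p).le hp0]
    _ ≤ B ^ p := pow_le_pow_left₀ (Real.rpow_nonneg (hpos p).le _) (hB p hp) p

lemma Preceq.trans_of_pos {M N P : ℕ → ℝ} (hM : ∀ p, 0 < M p) (hN : ∀ p, 0 < N p)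
    (hP : ∀ p, 0 < P p) (h₁ : Preceq M N) (h₂ : Preceq N P) : Preceq M P := by
  obtain ⟨D, hD, hMN⟩ := h₁.exists_le_pow_mul hM hN
  obtain ⟨E, hE, hNP⟩ := h₂.exists_le_pow_mul hN hP
  refine preceq_of_le_pow_mul hM hP (mul_nonneg hD.le hE.le) fun p hp => ?_
  calc M p ≤ D ^ p * N p := hMN p hp
    _ ≤ D ^ p * (E ^ p * P p) := by gcongr; exact hNP p hp
    _ = (D * E) ^ p * P p := by rw [mul_pow]; ring

lemma nuq_pos (hpos : ∀ p, 0 < N p) (p : ℕ) : 0 < nuq N p := div_pos (hpos _) (hpos _)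

lemma nuq_succ_mul (hpos : ∀ p, 0 < N p) (p : ℕ) : nuq N (p + 1) * N p = N (p + 1) := by
  simp only [nuq, Nat.add_sub_cancel]
  exact div_mul_cancel₀ _ (hpos p).ne'

lemma IsLC.nuq_le_nuq (hN : IsLC N) {p q : ℕ} (hp : 1 ≤ p) (hpq : p ≤ q) :
    nuq N p ≤ nuq N q := by
  obtain ⟨hpos, -, -, hlc, -⟩ := hN
  induction q, hpq using Nat.le_induction with
  | base => exact le_rfl
  | succ q hpq ih =>
    refine ih.trans ?_
    simp only [nuq, Nat.add_sub_cancel]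
    rw [div_le_div_iff₀ (hpos _) (hpos _)]
    nlinarith [hlc q (hp.trans hpq)]

lemma IsLC.nuq_pow_mul_le (hN : IsLC N) {q : ℕ} (hq : 1 ≤ q) (k : ℕ) :
    nuq N q ^ k * N q ≤ N (q + k) := by
  induction k with
  | zero => simp
  | succ k ih =>
    calc nuq N q ^ (k + 1) * N q = nuq N q * (nuq N q ^ k * N q) := by ring
      _ ≤ nuq N (q + k + 1) * N (q + k) :=
        mul_le_mul (hN.nuq_le_nuq hq (by omega)) ih
          (mul_pos (pow_pos (nuq_pos hN.1 _) _) (hN.1 _)).le (nuq_pos hN.1 _).le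
      _ = N (q + (k + 1)) := nuq_succ_mul hN.1 _

lemma IsLC.le_nuq_pow_mul (hN : IsLC N) {j p : ℕ} (hjp : j ≤ p) :
    N p ≤ nuq N p ^ (p - j) * N j := by
  obtain ⟨k, rfl⟩ := Nat.exists_eq_add_of_le hjp
  rw [Nat.add_sub_cancel_left]
  clear hjp
  induction k with
  | zero => simp
  | succ k ih =>
    rcases Nat.eq_zero_or_pos (j + k) with h0 | h0
    · obtain ⟨rfl, rfl⟩ : j = 0 ∧ k = 0 := by omega
      simpa using (nuq_succ_mul hN.1 0).ge
    · have hmono : nuq N (j + k) ≤ nuq N (j + k + 1) := hN.nuq_le_nuq h0 (by omega)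
      calc N (j + (k + 1)) = nuq N (j + k + 1) * N (j + k) := (nuq_succ_mul hN.1 _).symm
        _ ≤ nuq N (j + k + 1) * (nuq N (j + k + 1) ^ k * N j) := by
          refine mul_le_mul_of_nonneg_left (ih.trans ?_) (nuq_pos hN.1 _).le
          exact mul_le_mul_of_nonneg_right
            (pow_le_pow_left₀ (nuq_pos hN.1 _).le hmono k) (hN.1 j).le
        _ = nuq N (j + (k + 1)) ^ (k + 1) * N j := by rw [← add_assoc]; ring

lemma NQA.summable_tail (hnq : NQA N) {p : ℕ} (hp : 1 ≤ p) :
    Summable fun k : ℕ => 1 / nuq N (p + k) := by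
  obtain ⟨m, rfl⟩ := Nat.exists_eq_add_of_le' hp
  refine ((summable_nat_add_iff m).2 hnq).congr fun k => ?_
  rw [show k + m + 1 = m + 1 + k by ring]

lemma one_div_nuq_le_tailSum (hpos : ∀ p, 0 < N p) (hnq : NQA N) {p : ℕ} (hp : 1 ≤ p) :
    1 / nuq N p ≤ tailSum N p :=
  (hnq.summable_tail hp).le_tsum 0 fun k _ => (one_div_pos.2 (nuq_pos hpos (p + k))).le

lemma tailSum_pos (hpos : ∀ p, 0 < N p) (hnq : NQA N) {p : ℕ} (hp : 1 ≤ p) :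
    0 < tailSum N p :=
  (one_div_pos.2 (nuq_pos hpos p)).trans_le (one_div_nuq_le_tailSum hpos hnq hp)

lemma NQA.tailSum_eq_sum_add (hnq : NQA N) {p : ℕ} (hp : 1 ≤ p) (m : ℕ) :
    tailSum N p = ∑ k ∈ Finset.range m, 1 / nuq N (p + k) + tailSum N (p + m) := by
  rw [tailSum, ← (hnq.summable_tail hp).sum_add_tsum_nat_add m, tailSum]
  congr 1
  refine tsum_congr fun k => ?_
  rw [show p + (k + m) = p + m + k by ring]

lemma tauD_pos (hpos : ∀ p, 0 < N p) (hnq : NQA N) {p : ℕ} (hp : 1 ≤ p) : 0 < tauD N p :=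
  add_pos_of_nonneg_of_pos (div_nonneg p.cast_nonneg (nuq_pos hpos p).le)
    (tailSum_pos hpos hnq hp)

lemma sigmaD_pos (hpos : ∀ p, 0 < N p) (hnq : NQA N) (p : ℕ) : 0 < sigmaD N p := by
  unfold sigmaD
  split_ifs with hp
  · exact one_pos
  · have hp1 : 1 ≤ p := by omega
    exact div_pos (mul_pos (tauD_pos hpos hnq le_rfl) (by exact_mod_cast hp1))
      (tauD_pos hpos hnq hp1)

lemma Sdesc_pos (hpos : ∀ p, 0 < N p) (hnq : NQA N) (p : ℕ) : 0 < Sdesc N p :=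
  Finset.prod_pos fun i _ => sigmaD_pos hpos hnq i

lemma Sdesc_succ (p : ℕ) : Sdesc N (p + 1) = Sdesc N p * sigmaD N (p + 1) :=
  Finset.prod_range_succ _ _

lemma sigmaD_le (hpos : ∀ p, 0 < N p) (hnq : NQA N) {p : ℕ} (hp : 1 ≤ p) :
    sigmaD N p ≤ tauD N 1 * nuq N p := by
  have hν := nuq_pos hpos p
  have hT := tailSum_pos hpos hnq hp
  have h1 := tauD_pos hpos hnq (p := 1) le_rfl
  rw [sigmaD, if_neg (by omega), div_le_iff₀ (tauD_pos hpos hnq hp), mul_assoc]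
  refine mul_le_mul_of_nonneg_left ?_ h1.le
  have : nuq N p * tauD N p = p + nuq N p * tailSum N p := by
    unfold tauD; field_simp
  rw [this]
  nlinarith [mul_pos hν hT]

/-- The descendant of `N` is always dominated by `N`. -/
lemma IsLC.Sdesc_preceq (hN : IsLC N) (hnq : NQA N) : Preceq (Sdesc N) N := by
  have h1 := tauD_pos hN.1 hnq (p := 1) le_rfl
  refine preceq_of_le_pow_mul (Sdesc_pos hN.1 hnq) hN.1 h1.le fun p _ => ?_
  induction p with
  | zero => simp [Sdesc, sigmaD, hN.2.1]
  | succ p ih =>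
    rcases Nat.eq_zero_or_pos p with rfl | hp
    · have h := sigmaD_le hN.1 hnq (p := 1) le_rfl
      simpa [Sdesc, Finset.prod_range_succ, sigmaD, nuq, hN.2.1] using h
    · calc Sdesc N (p + 1) = Sdesc N p * sigmaD N (p + 1) := Sdesc_succ p
        _ ≤ (tauD N 1 ^ p * N p) * (tauD N 1 * nuq N (p + 1)) :=
          mul_le_mul (ih hp) (sigmaD_le hN.1 hnq (by omega)) (sigmaD_pos hN.1 hnq _).le
            (mul_pos (pow_pos h1 p) (hN.1 p)).le
        _ = tauD N 1 ^ (p + 1) * (nuq N (p + 1) * N p) := by ring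
        _ = tauD N 1 ^ (p + 1) * N (p + 1) := by rw [nuq_succ_mul hN.1]

/-- Under `(γ₁)` the sequence `N` is dominated by its descendant. -/
lemma Gamma1.preceq_Sdesc (hg : Gamma1 N) (hN : IsLC N) (hnq : NQA N) :
    Preceq N (Sdesc N) := by
  obtain ⟨B, hB⟩ := hg
  have h1 := tauD_pos hN.1 hnq (p := 1) le_rfl
  have hB0 : 0 < B := by
    refine lt_of_lt_of_le ?_ (hB 1 le_rfl)
    have := mul_pos (nuq_pos hN.1 1) (tailSum_pos hN.1 hnq (p := 1) le_rfl)
    simpa using this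
  set D : ℝ := (1 + B) / tauD N 1 with hD
  have hD0 : 0 < D := by positivity
  have hstep : ∀ p, 1 ≤ p → nuq N p ≤ D * sigmaD N p := by
    intro p hp
    have hp' : (0 : ℝ) < p := by exact_mod_cast hp
    have hν := nuq_pos hN.1 p
    have hτ := tauD_pos hN.1 hnq hp
    have hb : nuq N p * tailSum N p ≤ B * p := by
      have := hB p hp
      rwa [div_mul_eq_mul_div, div_le_iff₀ hp'] at this
    have hντ : nuq N p * tauD N p = p + nuq N p * tailSum N p := by
      unfold tauD; field_simp
    have hσ : D * sigmaD N p = (1 + B) * p / tauD N p := by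
      rw [sigmaD, if_neg (by omega), hD]; field_simp
    rw [hσ, le_div_iff₀ hτ, hντ]
    linarith
  refine preceq_of_le_pow_mul hN.1 (Sdesc_pos hN.1 hnq) hD0.le fun p _ => ?_
  clear * - hN hstep hD0 hnq
  induction p with
  | zero => simp [Sdesc, sigmaD, hN.2.1]
  | succ p ih =>
    calc N (p + 1) = nuq N (p + 1) * N p := (nuq_succ_mul hN.1 p).symm
      _ ≤ (D * sigmaD N (p + 1)) * (D ^ p * Sdesc N p) :=
        mul_le_mul (hstep _ (by omega)) ih (hN.1 p).le
          (mul_pos hD0 (sigmaD_pos hN.1 hnq _)).le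
      _ = D ^ (p + 1) * Sdesc N (p + 1) := by rw [Sdesc_succ]; ring

lemma LseqC_of_pos (s : ℕ) (C : ℝ) {p : ℕ} (hp : 1 ≤ p) :
    LseqC N s C p =
      (s : ℝ) ^ p * ⨅ j : Fin p, (C * p / tailSum N p) ^ (p - (j : ℕ)) * N j := by
  rw [LseqC, if_neg (by omega)]

lemma LseqC_pos (hpos : ∀ p, 0 < N p) (hnq : NQA N) {s : ℕ} (hs : 1 ≤ s) {C : ℝ} (hC : 1 ≤ C)
    (p : ℕ) : 0 < LseqC N s C p := by
  rcases Nat.eq_zero_or_pos p with rfl | hp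
  · simp [LseqC]
  · have : Nonempty (Fin p) := ⟨⟨0, hp⟩⟩
    rw [LseqC_of_pos s C hp]
    obtain ⟨j, hj⟩ := exists_eq_ciInf_of_finite
      (f := fun j : Fin p => (C * p / tailSum N p) ^ (p - (j : ℕ)) * N j)
    have hp' : (0 : ℝ) < p := by exact_mod_cast hp
    have hs' : (0 : ℝ) < s := by exact_mod_cast hs
    have hT := tailSum_pos hpos hnq hp
    have hj0 := hpos j
    rw [← hj]
    positivity

lemma LseqC_le (s : ℕ) (C : ℝ) {j p : ℕ} (hjp : j < p) :
    LseqC N s C p ≤ (s : ℝ) ^ p * ((C * p / tailSum N p) ^ (p - j) * N j) := by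
  rw [LseqC_of_pos s C (by omega)]
  exact mul_le_mul_of_nonneg_left
    (ciInf_le (Set.finite_range _).bddBelow (⟨j, hjp⟩ : Fin p)) (by positivity)

/-- The sequence `L^{s,C}` is always dominated by `N`. -/
lemma IsLC.LseqC_preceq (hN : IsLC N) (hnq : NQA N) {s : ℕ} (hs : 1 ≤ s) {C : ℝ} (hC : 1 ≤ C) :
    Preceq (LseqC N s C) N := by
  have hC0 : 0 ≤ C := by linarith
  refine preceq_of_le_pow_mul (LseqC_pos hN.1 hnq hs hC) hN.1
    (D := s * (C * 2)) (by positivity) fun p hp => ?_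
  obtain ⟨q, rfl⟩ := Nat.exists_eq_add_of_le' hp
  have hν := nuq_pos hN.1 (q + 1)
  have hT := tailSum_pos hN.1 hnq hp
  have hNq := hN.1 q
  have hTν : 1 / tailSum N (q + 1) ≤ nuq N (q + 1) := by
    rw [one_div_le hT hν]
    exact one_div_nuq_le_tailSum hN.1 hnq hp
  have hpow : ((q + 1 : ℕ) : ℝ) ≤ 2 ^ (q + 1) := by exact_mod_cast Nat.lt_two_pow_self.le
  calc LseqC N s C (q + 1)
      ≤ (s : ℝ) ^ (q + 1) *
          ((C * (q + 1 : ℕ) / tailSum N (q + 1)) ^ (q + 1 - q) * N q) :=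
        LseqC_le s C q.lt_succ_self
    _ = (s : ℝ) ^ (q + 1) * (C * (q + 1 : ℕ) * (1 / tailSum N (q + 1)) * N q) := by
        rw [Nat.add_sub_cancel_left, pow_one]; ring
    _ ≤ (s : ℝ) ^ (q + 1) * (C ^ (q + 1) * 2 ^ (q + 1) * nuq N (q + 1) * N q) := by
        gcongr
        exact le_self_pow₀ hC (by omega)
    _ = (s * (C * 2)) ^ (q + 1) * (nuq N (q + 1) * N q) := by
        rw [mul_pow, mul_pow]; ring
    _ = (s * (C * 2)) ^ (q + 1) * N (q + 1) := by rw [nuq_succ_mul hN.1]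

/-- Under `(γ₁)` the sequence `N` is dominated by `L^{s,C}`. -/
lemma Gamma1.preceq_LseqC (hg : Gamma1 N) (hN : IsLC N) (hnq : NQA N) {s : ℕ} (hs : 1 ≤ s)
    {C : ℝ} (hC : 1 ≤ C) : Preceq N (LseqC N s C) := by
  obtain ⟨B, hB⟩ := hg
  set D : ℝ := max B 1
  have hD1 : 1 ≤ D := le_max_right _ _
  have hD0 : 0 < D := by linarith
  refine preceq_of_le_pow_mul hN.1 (LseqC_pos hN.1 hnq hs hC) hD0.le fun p hp => ?_
  have : Nonempty (Fin p) := ⟨⟨0, hp⟩⟩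
  have hp' : (0 : ℝ) < p := by exact_mod_cast hp
  have hs' : (1 : ℝ) ≤ s := by exact_mod_cast hs
  have hν := nuq_pos hN.1 p
  have hT := tailSum_pos hN.1 hnq hp
  have hνle : nuq N p ≤ D * (C * p / tailSum N p) := by
    have h := (hB p hp).trans (le_max_left B 1)
    rw [div_mul_eq_mul_div, div_le_iff₀ hp'] at h
    rw [← mul_div_assoc, le_div_iff₀ hT]
    refine h.trans (mul_le_mul_of_nonneg_left ?_ hD0.le)
    nlinarith
  have hinf : N p / D ^ p ≤ ⨅ j : Fin p, (C * p / tailSum N p) ^ (p - (j : ℕ)) * N j := by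
    refine le_ciInf fun j => ?_
    have hNj := hN.1 j
    rw [div_le_iff₀ (pow_pos hD0 p)]
    calc N p ≤ nuq N p ^ (p - (j : ℕ)) * N j := hN.le_nuq_pow_mul j.2.le
      _ ≤ (D * (C * p / tailSum N p)) ^ (p - (j : ℕ)) * N j := by gcongr
      _ = (C * p / tailSum N p) ^ (p - (j : ℕ)) * N j * D ^ (p - (j : ℕ)) := by
        rw [mul_pow]; ring
      _ ≤ (C * p / tailSum N p) ^ (p - (j : ℕ)) * N j * D ^ p := by
        gcongr
        omega
  have hNp := hN.1 p
  rw [LseqC_of_pos s C hp, ← div_le_iff₀' (pow_pos hD0 p)]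
  refine hinf.trans (le_mul_of_one_le_left ?_ (one_le_pow₀ hs'))
  exact (div_pos hNp (pow_pos hD0 p)).le.trans hinf

/-- If `N` is dominated by `L^{s,C}`, then `N` satisfies `(γ₁)`. -/
lemma gamma1_of_preceq_LseqC (hN : IsLC N) (hnq : NQA N) {s : ℕ} (hs : 1 ≤ s) {C : ℝ}
    (hC : 1 ≤ C) (h : Preceq N (LseqC N s C)) : Gamma1 N := by
  obtain ⟨D, hD, hle⟩ := h.exists_le_pow_mul hN.1 (LseqC_pos hN.1 hnq hs hC)
  have hs' : (0 : ℝ) < s := by exact_mod_cast hs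
  refine ⟨1 + (D * s) ^ 2 * (2 * C), fun q hq => ?_⟩
  have hq' : (0 : ℝ) < q := by exact_mod_cast hq
  have hν := nuq_pos hN.1 q
  have hT := tailSum_pos hN.1 hnq (p := q + q) (by omega)
  set X : ℝ := C * (q + q : ℕ) / tailSum N (q + q) with hX
  have hX0 : 0 ≤ X := by positivity
  have hpow : nuq N q ^ q ≤ ((D * s) ^ 2 * X) ^ q := by
    have hNq := hN.1 q
    refine le_of_mul_le_mul_right ?_ hNq
    calc nuq N q ^ q * N q ≤ N (q + q) := hN.nuq_pow_mul_le hq q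
      _ ≤ D ^ (q + q) * LseqC N s C (q + q) := hle _ (by omega)
      _ ≤ D ^ (q + q) * ((s : ℝ) ^ (q + q) * (X ^ (q + q - q) * N q)) := by
        gcongr
        exact LseqC_le s C (by omega)
      _ = ((D * s) ^ 2 * X) ^ q * N q := by
        rw [Nat.add_sub_cancel, mul_pow, ← pow_mul, mul_pow, two_mul]; ring
  have hνX : nuq N q ≤ (D * s) ^ 2 * X :=
    le_of_pow_le_pow_left₀ (by omega) (by positivity) hpow
  have htail : nuq N q * tailSum N (q + q) ≤ (D * s) ^ 2 * (2 * C) * q := by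
    calc nuq N q * tailSum N (q + q) ≤ (D * s) ^ 2 * X * tailSum N (q + q) := by gcongr
      _ = (D * s) ^ 2 * (2 * C) * q := by
        rw [hX]; push_cast; field_simp; ring
  have hhead : nuq N q * ∑ k ∈ Finset.range q, 1 / nuq N (q + k) ≤ q := by
    calc nuq N q * ∑ k ∈ Finset.range q, 1 / nuq N (q + k)
        ≤ nuq N q * ∑ _k ∈ Finset.range q, 1 / nuq N q := by
          refine mul_le_mul_of_nonneg_left (Finset.sum_le_sum fun k _ => ?_) hν.le
          exact one_div_le_one_div_of_le hν (hN.nuq_le_nuq hq (by omega))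
      _ = q := by
          rw [Finset.sum_const, Finset.card_range, nsmul_eq_mul]; field_simp
  rw [div_mul_eq_mul_div, div_le_iff₀ hq', hnq.tailSum_eq_sum_add hq q, mul_add]
  linarith

lemma Gamma1.seqEquiv_Sdesc_LseqC (hg : Gamma1 N) (hN : IsLC N) (hnq : NQA N) {s : ℕ}
    (hs : 1 ≤ s) {C : ℝ} (hC : 1 ≤ C) : SeqEquiv (Sdesc N) (LseqC N s C) :=
  have hS := Sdesc_pos hN.1 hnq
  have hL := LseqC_pos hN.1 hnq hs hC
  ⟨(hN.Sdesc_preceq hnq).trans_of_pos hS hN.1 hL (hg.preceq_LseqC hN hnq hs hC),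
    (hN.LseqC_preceq hnq hs hC).trans_of_pos hL hN.1 hS (hg.preceq_Sdesc hN hnq)⟩

end WeightSequences

theorem stmt10 (N : ℕ → ℝ) (hN : IsLC N) (hnq : NQA N)
    (s : ℕ) (hs : 1 ≤ s) (C : ℝ) (hC : 1 ≤ C)
    (hne : ¬ SeqEquiv (Sdesc N) (LseqC N s C)) :
    ¬ Gamma1 N ∧ ¬ SeqEquiv N (LseqC N s C) := by
  have key : ¬ Gamma1 N := fun hg => hne (hg.seqEquiv_Sdesc_LseqC hN hnq hs hC)
  exact ⟨key, fun h => key (gamma1_of_preceq_LseqC hN hnq hs hC h.1)⟩
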